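/- arXiv:2601.05771 — 3 statements merged into one kernel-verified Lean document; each statement's English description precedes it below -/
import Mathlib

section
/- Let T = (V, E) be a tree on n vertices and let uv be a centre edge of T with |V_u| ≤ n/2. Let T′ = (V′, E′) be a tree obtained from T by adding one pendant vertex, and let u′v′ be a centre edge of T′ with |V′_{u′}| ≤ (n+1)/2. Then |V_u| ≤ |V′_{u′}|. -/
open Finset

/-- The number of vertices of the component of `G - uv` containing `u`, i.e. `|V_u|`. -/
noncomputable def sideCard {V : Type*} [Fintype V] (G : SimpleGraph V) (u v : V) : ℕ :=
  Nat.card {w : V | (G.deleteEdges {s(u, v)}).Reachable u w}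
/-- `uv` is a centre edge of `T`: it is an edge minimizing `| |V_u| - |V_v| |`
over all edges of `T`. -/
def IsCentreEdge {V : Type*} [Fintype V] (T : SimpleGraph V) (u v : V) : Prop :=
  T.Adj u v ∧ ∀ a b, T.Adj a b →
    |(sideCard T u v : ℤ) - (sideCard T v u : ℤ)| ≤
      |(sideCard T a b : ℤ) - (sideCard T b a : ℤ)|
/-- The graph obtained from `G` by attaching `r` new pendant vertices, the `j`-th new
vertex being adjacent exactly to the vertex `f j` of `G`. -/
def attachPendants {V : Type*} (G : SimpleGraph V) {r : ℕ} (f : Fin r → V) :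
    SimpleGraph (V ⊕ Fin r) :=
  SimpleGraph.fromRel (fun a b =>
    (∃ x y, a = Sum.inl x ∧ b = Sum.inl y ∧ G.Adj x y) ∨
    (∃ j, b = Sum.inr j ∧ a = Sum.inl (f j)))

/-- Deleting one edge of a preconnected graph leaves every vertex reachable from one of the two
endpoints. -/
lemma SimpleGraph.Preconnected.reachable_deleteEdges_or {V : Type*} {G : SimpleGraph V}
    (hG : G.Preconnected) (u v w : V) :
    (G.deleteEdges {s(u, v)}).Reachable u w ∨ (G.deleteEdges {s(v, u)}).Reachable v w := by
  have h := (SimpleGraph.reachable_iff_reflTransGen u w).1 (hG u w)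
  induction h with
  | refl => exact Or.inl (SimpleGraph.Reachable.refl u)
  | @tail b c _ hbc ih =>
    by_cases hc : s(b, c) = s(u, v)
    · rcases Sym2.eq_iff.1 hc with ⟨-, rfl⟩ | ⟨-, rfl⟩
      · exact Or.inr (SimpleGraph.Reachable.refl _)
      · exact Or.inl (SimpleGraph.Reachable.refl _)
    · have hadj : (G.deleteEdges {s(u, v)}).Adj b c := by
        simpa [SimpleGraph.deleteEdges_adj, hbc] using hc
      rw [Sym2.eq_swap (a := v)] at ih ⊢
      exact ih.imp (fun h => h.trans hadj.reachable) (fun h => h.trans hadj.reachable)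

lemma card_le_sideCard_add_sideCard {V : Type*} [Fintype V] {G : SimpleGraph V}
    (hG : G.Preconnected) (u v : V) :
    Fintype.card V ≤ sideCard G u v + sideCard G v u := by
  have hU : {w : V | (G.deleteEdges {s(u, v)}).Reachable u w} ∪
      {w : V | (G.deleteEdges {s(v, u)}).Reachable v w} = Set.univ :=
    Set.eq_univ_of_forall fun w => hG.reachable_deleteEdges_or u v w
  have h := Set.ncard_union_le {w : V | (G.deleteEdges {s(u, v)}).Reachable u w}
    {w : V | (G.deleteEdges {s(v, u)}).Reachable v w}
  rw [hU, Set.ncard_univ, Nat.card_eq_fintype_card] at h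
  exact h

lemma sideCard_add_sideCard_le_card {V : Type*} [Fintype V] {G : SimpleGraph V} {u v : V}
    (h : ¬ (G.deleteEdges {s(u, v)}).Reachable u v) :
    sideCard G u v + sideCard G v u ≤ Fintype.card V := by
  have hd : Disjoint {w : V | (G.deleteEdges {s(u, v)}).Reachable u w}
      {w : V | (G.deleteEdges {s(v, u)}).Reachable v w} := by
    refine Set.disjoint_left.2 fun w hu hv => h ?_
    rw [Set.mem_ofPred_eq, Sym2.eq_swap] at hv
    exact hu.trans hv.symm
  have hc := Set.ncard_union_eq hd (Set.toFinite _) (Set.toFinite _)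
  have hle := Set.ncard_le_card ({w : V | (G.deleteEdges {s(u, v)}).Reachable u w} ∪
      {w : V | (G.deleteEdges {s(v, u)}).Reachable v w})
  rw [hc, Nat.card_eq_fintype_card] at hle
  exact hle

section attachPendants

variable {V : Type*} {G : SimpleGraph V} {r : ℕ} {f : Fin r → V}

lemma attachPendants_adj_inl_inl {x y : V} :
    (attachPendants G f).Adj (Sum.inl x) (Sum.inl y) ↔ G.Adj x y := by
  simp only [attachPendants, SimpleGraph.fromRel_adj]
  constructor
  · rintro ⟨-, (⟨a, b, ha, hb, h⟩ | ⟨j, h, -⟩) | (⟨a, b, ha, hb, h⟩ | ⟨j, h, -⟩)⟩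
    · cases ha; cases hb; exact h
    · cases h
    · cases ha; cases hb; exact h.symm
    · cases h
  · exact fun h => ⟨by simpa using h.ne, Or.inl (Or.inl ⟨x, y, rfl, rfl, h⟩)⟩

lemma attachPendants_adj_inl_inr {x : V} {j : Fin r} :
    (attachPendants G f).Adj (Sum.inl x) (Sum.inr j) ↔ x = f j := by
  simp [attachPendants, SimpleGraph.fromRel_adj]

lemma not_attachPendants_adj_inr_inr {i j : Fin r} :
    ¬ (attachPendants G f).Adj (Sum.inr i) (Sum.inr j) := by
  simp [attachPendants, SimpleGraph.fromRel_adj]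

lemma attachPendants_preconnected (hG : G.Preconnected) :
    (attachPendants G f).Preconnected := by
  let φ : G →g attachPendants G f := ⟨Sum.inl, fun h => attachPendants_adj_inl_inl.2 h⟩
  have hinl (x y : V) : (attachPendants G f).Reachable (Sum.inl x) (Sum.inl y) :=
    (hG x y).map φ
  have hinr (j : Fin r) : (attachPendants G f).Reachable (Sum.inl (f j)) (Sum.inr j) :=
    (attachPendants_adj_inl_inr.2 rfl).reachable
  rintro (x | i) (y | j)
  · exact hinl x y
  · exact (hinl x _).trans (hinr j)
  · exact (hinr i).symm.trans (hinl _ y)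
  · exact ((hinr i).symm.trans (hinl _ _)).trans (hinr j)

lemma reachable_deleteEdges_attachPendants_inl {u v x y : V}
    (h : (G.deleteEdges {s(u, v)}).Reachable x y) :
    ((attachPendants G f).deleteEdges {s(Sum.inl u, Sum.inl v)}).Reachable
      (Sum.inl x) (Sum.inl y) := by
  let φ : G.deleteEdges {s(u, v)} →g
      (attachPendants G f).deleteEdges {s(Sum.inl u, Sum.inl v)} :=
    ⟨Sum.inl, fun {a b} h => by
      rw [SimpleGraph.deleteEdges_adj] at h ⊢
      exact ⟨attachPendants_adj_inl_inl.2 h.1, by simpa using h.2⟩⟩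
  exact h.map φ

lemma reachable_deleteEdges_of_attachPendants {u v : V} {a b : V ⊕ Fin r}
    (h : ((attachPendants G f).deleteEdges {s(Sum.inl u, Sum.inl v)}).Reachable a b) :
    (G.deleteEdges {s(u, v)}).Reachable (Sum.elim id f a) (Sum.elim id f b) := by
  rw [SimpleGraph.reachable_iff_reflTransGen] at h
  induction h with
  | refl => exact SimpleGraph.Reachable.refl _
  | @tail b c _ hbc ih =>
    refine ih.trans ?_
    rw [SimpleGraph.deleteEdges_adj] at hbc
    obtain ⟨hadj, hne⟩ := hbc
    rcases b with x | i <;> rcases c with y | j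
    · refine SimpleGraph.Adj.reachable ?_
      rw [SimpleGraph.deleteEdges_adj]
      exact ⟨attachPendants_adj_inl_inl.1 hadj, by simpa using hne⟩
    · simp [attachPendants_adj_inl_inr.1 hadj]
    · simp [attachPendants_adj_inl_inr.1 hadj.symm]
    · exact absurd hadj not_attachPendants_adj_inr_inr

lemma sideCard_le_sideCard_attachPendants [Fintype V] (u v : V) :
    sideCard G u v ≤ sideCard (attachPendants G f) (Sum.inl u) (Sum.inl v) :=
  Set.ncard_le_ncard_of_injOn Sum.inl
    (fun _ hw => reachable_deleteEdges_attachPendants_inl hw) Sum.inl_injective.injOn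
    (Set.toFinite _)

end attachPendants

/-- Let `T` be a tree on `n` vertices, `uv` a centre edge of `T` with
`|V_u| ≤ n/2`.  Let `T'` be obtained from `T` by adding one pendant vertex, and let
`u'v'` be a centre edge of `T'` with `|V'_{u'}| ≤ (n+1)/2`.  Then `|V_u| ≤ |V'_{u'}|`. -/
theorem stmt8 {V : Type*} [Fintype V] (T : SimpleGraph V) (hT : T.IsTree)
    (u v : V) (huv : IsCentreEdge T u v)
    (hu : 2 * sideCard T u v ≤ Fintype.card V)
    (f : Fin 1 → V) (u' v' : V ⊕ Fin 1)
    (hu'v' : IsCentreEdge (attachPendants T f) u' v')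
    (hu' : 2 * sideCard (attachPendants T f) u' v' ≤ Fintype.card V + 1) :
    sideCard T u v ≤ sideCard (attachPendants T f) u' v' := by
  have hbridge : ¬ (T.deleteEdges {s(u, v)}).Reachable u v :=
    SimpleGraph.isBridge_iff.1 (SimpleGraph.isAcyclic_iff_forall_adj_isBridge.1 hT.isAcyclic huv.1)
  have hT' : (attachPendants T f).Preconnected :=
    attachPendants_preconnected hT.connected.preconnected
  have hsum := card_le_sideCard_add_sideCard hT.connected.preconnected u v
  have hsum' := card_le_sideCard_add_sideCard hT' u' v'
  have hsum_uv := sideCard_add_sideCard_le_card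
    (fun h => hbridge (reachable_deleteEdges_of_attachPendants (f := f) h))
  have hle := sideCard_le_sideCard_attachPendants (G := T) (f := f) u v
  have hle' := sideCard_le_sideCard_attachPendants (G := T) (f := f) v u
  have hmin := hu'v'.2 _ _ (attachPendants_adj_inl_inl.2 huv.1)
  simp only [Fintype.card_sum, Fintype.card_fin] at hsum' hsum_uv
  rw [abs_eq_max_neg, abs_eq_max_neg] at hmin
  omega
end

section
/- Let T = (V, E) be a tree, let u be a star-root vertex of T, and let uv ∈ E. Then |V_u| ≥ |V_v|. -/
open Finset

/-- `u` is a star-root vertex of the tree `T`:  `u` is an endpoint of some centre edge,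
`u` lies on every centre edge (so if there are at least two centre edges, `u` is the
centre of the substar they form), and if the centre edge `uv` is unique then
`|V_u| ≥ |V_v|`. -/
def IsStarRoot {V : Type*} [Fintype V] (T : SimpleGraph V) (u : V) : Prop :=
  (∃ v, IsCentreEdge T u v) ∧
  (∀ a b, IsCentreEdge T a b → u = a ∨ u = b) ∧
  ∀ v, IsCentreEdge T u v →
    (∀ a b, IsCentreEdge T a b → s(a, b) = s(u, v)) →
    sideCard T v u ≤ sideCard T u v

namespace SimpleGraph

variable {V : Type*} {G : SimpleGraph V}

/-- In an acyclic graph, deleting an edge separates its endpoints. -/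
theorem IsAcyclic.not_reachable_deleteEdges (hG : G.IsAcyclic) {u v : V} (h : G.Adj u v) :
    ¬ (G.deleteEdges {s(u, v)}).Reachable u v :=
  isBridge_iff.1 (isAcyclic_iff_forall_adj_isBridge.1 hG h)

theorem Reachable.deleteEdges_left_or_right {u x : V} (v : V) (h : G.Reachable u x) :
    (G.deleteEdges {s(u, v)}).Reachable u x ∨ (G.deleteEdges {s(u, v)}).Reachable v x := by
  rw [reachable_iff_reflTransGen] at h
  induction h with
  | refl => exact Or.inl (Reachable.refl _)
  | @tail x y _ hxy ih =>
    by_cases he : s(x, y) = s(u, v)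
    · rcases Sym2.eq_iff.1 he with ⟨-, rfl⟩ | ⟨-, rfl⟩
      · exact Or.inr (Reachable.refl _)
      · exact Or.inl (Reachable.refl _)
    · have hadj : (G.deleteEdges {s(u, v)}).Adj x y := by
        simpa [deleteEdges_adj, hxy] using he
      exact ih.imp (·.trans hadj.reachable) (·.trans hadj.reachable)

/-- For distinct edges `uv` and `uw` of an acyclic graph, the component of `w` in `G - uw` is
contained in the component of `u` in `G - uv`. -/
theorem IsAcyclic.reachable_deleteEdges_of_ne (hG : G.IsAcyclic) {u v w x : V}
    (huw : G.Adj u w) (hne : w ≠ v) (h : (G.deleteEdges {s(w, u)}).Reachable w x) :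
    (G.deleteEdges {s(u, v)}).Reachable u x := by
  have hsep := hG.not_reachable_deleteEdges huw.symm
  rw [reachable_iff_reflTransGen] at h
  induction h with
  | refl =>
    refine Adj.reachable ?_
    rw [deleteEdges_adj]
    exact ⟨huw, fun he => hne (Sym2.congr_right.1 he)⟩
  | @tail x y hx hxy ih =>
    refine ih.trans (Adj.reachable ?_)
    rw [← reachable_iff_reflTransGen] at hx
    rw [deleteEdges_adj]
    refine ⟨(deleteEdges_adj.1 hxy).1, fun he => ?_⟩
    rcases Sym2.eq_iff.1 he with ⟨rfl, -⟩ | ⟨-, rfl⟩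
    · exact hsep hx
    · exact hsep (hx.trans hxy.reachable)

end SimpleGraph

theorem sideCard_add_sideCard {V : Type*} [Fintype V] {T : SimpleGraph V} (hT : T.IsTree)
    {u v : V} (huv : T.Adj u v) : sideCard T u v + sideCard T v u = Nat.card V := by
  have hcompl : {w : V | (T.deleteEdges {s(v, u)}).Reachable v w} =
      {w : V | (T.deleteEdges {s(u, v)}).Reachable u w}ᶜ := by
    ext x
    rw [Sym2.eq_swap]
    exact ⟨fun hv hu => hT.isAcyclic.not_reachable_deleteEdges huv (hu.trans hv.symm),
      ((hT.connected u x).deleteEdges_left_or_right v).resolve_left⟩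
  simp only [sideCard, hcompl]
  exact Set.ncard_add_ncard_compl _

theorem sideCard_lt_sideCard {V : Type*} [Fintype V] {T : SimpleGraph V} (hT : T.IsAcyclic)
    {u v w : V} (huw : T.Adj u w) (hne : w ≠ v) : sideCard T w u < sideCard T u v :=
  Set.ncard_lt_ncard ⟨fun _ => hT.reachable_deleteEdges_of_ne huw hne, fun h =>
    hT.not_reachable_deleteEdges huw.symm (h (SimpleGraph.Reachable.refl u))⟩

/-- Let `T` be a tree, `u` a star-root vertex of `T` and `uv` an edge
of `T`.  Then `|V_u| ≥ |V_v|`. -/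
theorem stmt10 {V : Type*} [Fintype V] (T : SimpleGraph V) (hT : T.IsTree)
    (u : V) (hu : IsStarRoot T u) (v : V) (huv : T.Adj u v) :
    sideCard T v u ≤ sideCard T u v := by
  by_contra! hlt
  obtain ⟨⟨w, hw⟩, hroot, huniq⟩ := hu
  obtain ⟨w, hw, hne⟩ : ∃ w, IsCentreEdge T u w ∧ w ≠ v := by
    by_contra! h
    obtain rfl := h w hw
    refine (huniq w hw fun a b hab => ?_).not_gt hlt
    rcases hroot a b hab with rfl | rfl
    · rw [h b hab]
    · have hba : IsCentreEdge T u a :=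
        ⟨hab.1.symm, fun c d hcd => by rw [abs_sub_comm]; exact hab.2 c d hcd⟩
      rw [h a hba, Sym2.eq_swap]
  have hmin := hw.2 u v huv
  have hlt' := sideCard_lt_sideCard hT.isAcyclic hw.1 hne
  have hv := sideCard_add_sideCard hT huv
  have hw' := sideCard_add_sideCard hT hw.1
  rw [abs_of_nonneg (by omega), abs_of_neg (by omega)] at hmin
  omega
end

section
/- Let G be a connected finite simple graph on n ≥ 2 vertices, and let G^k be a graph obtained from G by successively adding k pendant vertices (i.e., G^0 = G and, for 1 ≤ i ≤ k, G^i is obtained from G^{i−1} by adding one new vertex adjacent to exactly one vertex of G^{i−1}). Then b(G^k) ≤ b(G) · ∏_{i=0}^{k−1} (1 − 1/(n+i)²). -/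
open Finset

open Classical in
/-- The ℓ1-Fiedler value `b(G)`: the minimum of `∑_{uv ∈ E(G)} |x_u - x_v|` over all
`x : V → ℝ` with `∑_v x_v = 0` and `∑_v |x_v| = 1`.  (Each edge `uv` contributes
`|x_u - x_v|` once; the double sum over ordered pairs counts it twice, whence the `1/2`.) -/
noncomputable def l1Fiedler {V : Type*} [Fintype V] (G : SimpleGraph V) : ℝ :=
  sInf { y : ℝ | ∃ x : V → ℝ, (∑ v, x v) = 0 ∧ (∑ v, |x v|) = 1 ∧
    y = (1 / 2) * ∑ u, ∑ v, if G.Adj u v then |x u - x v| else 0 }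
/-- The graph `G^k` obtained from `G` by successively adding `k` pendant vertices:
for each `i`, the new vertex `Sum.inr i` is adjacent exactly to `f i`, which (under the
hypothesis `∀ i j, f i = Sum.inr j → j < i`) is a vertex of the previously built graph
`G^i`. -/
def addPendantsSeq {V : Type*} (G : SimpleGraph V) {k : ℕ} (f : Fin k → V ⊕ Fin k) :
    SimpleGraph (V ⊕ Fin k) :=
  SimpleGraph.fromRel (fun a b =>
    (∃ x y, a = Sum.inl x ∧ b = Sum.inl y ∧ G.Adj x y) ∨
    (∃ j, b = Sum.inr j ∧ a = f j))

open Classical in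
/-- The total variation of `x` along the edges of `G`. -/
noncomputable def edgeVariation {V : Type*} [Fintype V] (G : SimpleGraph V) (x : V → ℝ) : ℝ :=
  (1 / 2) * ∑ u, ∑ v, if G.Adj u v then |x u - x v| else 0

theorem edgeVariation_nonneg {V : Type*} [Fintype V] (G : SimpleGraph V) (x : V → ℝ) :
    0 ≤ edgeVariation G x := by
  unfold edgeVariation
  refine mul_nonneg (by norm_num) (sum_nonneg fun u _ => sum_nonneg fun v _ => ?_)
  split_ifs <;> positivity

theorem edgeVariation_affine {V : Type*} [Fintype V] (G : SimpleGraph V) (x : V → ℝ) {c : ℝ}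
    (hc : 0 ≤ c) (d : ℝ) :
    edgeVariation G (fun v => c * x v + d) = c * edgeVariation G x := by
  unfold edgeVariation
  rw [mul_left_comm c]
  congr 1
  rw [mul_sum]
  refine sum_congr rfl fun u _ => ?_
  rw [mul_sum]
  refine sum_congr rfl fun v _ => ?_
  split_ifs
  · rw [show c * x u + d - (c * x v + d) = c * (x u - x v) by ring, abs_mul, abs_of_nonneg hc]
  · simp

theorem l1Fiedler_le_edgeVariation {V : Type*} [Fintype V] (G : SimpleGraph V) {x : V → ℝ}
    (h0 : ∑ v, x v = 0) (h1 : ∑ v, |x v| = 1) : l1Fiedler G ≤ edgeVariation G x := by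
  refine csInf_le ⟨0, ?_⟩ ⟨x, h0, h1, rfl⟩
  rintro _ ⟨y, -, -, rfl⟩
  exact edgeVariation_nonneg G y

theorem l1Fiedler_nonneg {V : Type*} [Fintype V] (G : SimpleGraph V) : 0 ≤ l1Fiedler G := by
  refine Real.sInf_nonneg ?_
  rintro _ ⟨y, -, -, rfl⟩
  exact edgeVariation_nonneg G y

theorem abs_indicator_superlevel_sub (a b t : ℝ) :
    |(if t ≤ a then (1 : ℝ) else 0) - (if t ≤ b then 1 else 0)| =
      (Set.uIoc a b).indicator 1 t := by
  by_cases ha : t ≤ a <;> by_cases hb : t ≤ b <;>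
    simp [Set.mem_uIoc, ha, hb, not_le.1, ← not_le]

/-- Coarea principle: a weighted sum of the differences `|x u - x v|` is nonnegative for every `x`
as soon as it is nonnegative for indicator functions. -/
theorem sum_mul_abs_sub_nonneg_of_indicator {V : Type*} [Fintype V] (w : V → V → ℝ)
    (h : ∀ S : Set V, 0 ≤ ∑ u, ∑ v, w u v * |S.indicator (1 : V → ℝ) u - S.indicator 1 v|)
    (x : V → ℝ) : 0 ≤ ∑ u, ∑ v, w u v * |x u - x v| := by
  have hint : ∀ a b : ℝ, MeasureTheory.Integrable ((Set.uIoc a b).indicator (1 : ℝ → ℝ)) := by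
    intro a b
    refine (MeasureTheory.integrable_indicator_iff measurableSet_uIoc).2 ?_
    refine MeasureTheory.integrableOn_const (C := (1 : ℝ)) ?_ (by simp)
    simp [Set.uIoc]
  have hval : ∀ a b : ℝ, ∫ t, (Set.uIoc a b).indicator (1 : ℝ → ℝ) t = |a - b| := by
    intro a b
    rw [MeasureTheory.integral_indicator_one measurableSet_uIoc]
    simp [Set.uIoc, MeasureTheory.measureReal_def, max_sub_min_eq_abs, abs_sub_comm]
  have key : ∑ u, ∑ v, w u v * |x u - x v| =
      ∫ t, ∑ u, ∑ v, w u v * (Set.uIoc (x u) (x v)).indicator (1 : ℝ → ℝ) t := by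
    rw [MeasureTheory.integral_finsetSum _ fun u _ => MeasureTheory.integrable_finsetSum _
      fun v _ => (hint _ _).const_mul _]
    refine sum_congr rfl fun u _ => ?_
    rw [MeasureTheory.integral_finsetSum _ fun v _ => (hint _ _).const_mul _]
    refine sum_congr rfl fun v _ => ?_
    rw [MeasureTheory.integral_const_mul, hval]
  rw [key]
  refine MeasureTheory.integral_nonneg fun t => ?_
  have := h {v | t ≤ x v}
  simp only [Set.indicator_apply, Set.mem_ofPred_eq, Pi.one_apply,
    abs_indicator_superlevel_sub] at this
  exact this

/-- The vertex of the original graph from which a vertex of the extended graph descends. -/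
theorem exists_pendant_root {V : Type*} {k : ℕ} (f : Fin k → V ⊕ Fin k)
    (hf : ∀ i j, f i = Sum.inr j → (j : ℕ) < (i : ℕ)) :
    ∃ r : V ⊕ Fin k → V, (∀ v, r (Sum.inl v) = v) ∧ ∀ i, r (Sum.inr i) = r (f i) := by
  let g : Fin k → V := WellFounded.fix (measure (fun i : Fin k => (i : ℕ))).wf
    fun i ih => match h : f i with
      | Sum.inl v => v
      | Sum.inr j => ih j (hf i j h)
  refine ⟨Sum.elim id g, fun v => rfl, fun i => ?_⟩
  change g i = _
  simp only [g]
  rw [WellFounded.fix_eq]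
  split
  · rename_i v h
    simp [h]
  · rename_i j h
    simp [h]

theorem edgeVariation_addPendantsSeq {V : Type*} [Fintype V] (G : SimpleGraph V) {k : ℕ}
    (f : Fin k → V ⊕ Fin k) (r : V ⊕ Fin k → V) (hr : ∀ v, r (Sum.inl v) = v)
    (hrf : ∀ i, r (Sum.inr i) = r (f i)) (x : V → ℝ) :
    edgeVariation (addPendantsSeq G f) (fun a => x (r a)) = edgeVariation G x := by
  have hll : ∀ u v, (addPendantsSeq G f).Adj (Sum.inl u) (Sum.inl v) ↔ G.Adj u v := by
    intro u v
    simp only [addPendantsSeq, SimpleGraph.fromRel_adj]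
    constructor
    · rintro ⟨-, (⟨a, b, h1, h2, h⟩ | ⟨j, h, -⟩) | (⟨a, b, h1, h2, h⟩ | ⟨j, h, -⟩)⟩
      · cases h1; cases h2; exact h
      · cases h
      · cases h1; cases h2; exact h.symm
      · cases h
    · intro h
      exact ⟨fun e => h.ne (Sum.inl.inj e), Or.inl (Or.inl ⟨u, v, rfl, rfl, h⟩)⟩
  have hr' : ∀ a i, (addPendantsSeq G f).Adj a (Sum.inr i) → r a = r (Sum.inr i) := by
    intro a i h
    simp only [addPendantsSeq, SimpleGraph.fromRel_adj] at h
    obtain ⟨-, (⟨_, _, -, h2, -⟩ | ⟨j, h, h'⟩) | (⟨_, _, h1, -, -⟩ | ⟨j, h, h'⟩)⟩ := h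
    · cases h2
    · rw [h, hrf, h']
    · cases h1
    · rw [h, hrf, h']
  have hz : ∀ a i, (addPendantsSeq G f).Adj a (Sum.inr i) → |x (r a) - x (r (Sum.inr i))| = 0 := by
    intro a i h
    rw [hr' a i h]; simp
  have hz' : ∀ a i, (addPendantsSeq G f).Adj (Sum.inr i) a → |x (r (Sum.inr i)) - x (r a)| = 0 := by
    intro a i h
    rw [hr' a i h.symm]; simp
  classical
  unfold edgeVariation
  congr 1
  rw [Fintype.sum_sum_type]
  have h2 : ∀ p : Prop, ∀ [Decidable p], ∀ c : ℝ, (p → c = 0) → (if p then c else 0) = 0 := by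
    intro p _ c h
    split_ifs with hp
    exacts [h hp, rfl]
  rw [sum_eq_zero (s := (univ : Finset (Fin k)))
    fun i _ => sum_eq_zero fun a _ => h2 _ _ (hz' a i), add_zero]
  refine sum_congr rfl fun u _ => ?_
  rw [Fintype.sum_sum_type, sum_eq_zero (s := (univ : Finset (Fin k)))
    fun i _ => h2 _ _ (hz _ i), add_zero]
  refine sum_congr rfl fun v _ => ?_
  simp only [hll, hr]

/-- A two-valued test vector bounds the ℓ1-Fiedler value by a normalized edge cut. -/
theorem l1Fiedler_mul_card_le {V : Type*} [Fintype V] (G : SimpleGraph V) (S : Finset V)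
    {s t : ℕ} (hs : #S = s) (ht : s + t = Fintype.card V) (hs0 : 0 < s) (ht0 : 0 < t) :
    l1Fiedler G * (2 * s * t) ≤
      (s + t) * edgeVariation G ((S : Set V).indicator 1) := by
  classical
  have hsR : (0 : ℝ) < s := by exact_mod_cast hs0
  have htR : (0 : ℝ) < t := by exact_mod_cast ht0
  have hc : #(univ.filter fun v => v ∉ S) = t := by
    have := card_compl S
    rw [show Sᶜ = univ.filter fun v => v ∉ S by ext; simp] at this
    omega
  set c : ℝ := (s + t) / (2 * s * t) with hcdef
  set d : ℝ := -(1 / (2 * t)) with hddef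
  have hcd : c + d = 1 / (2 * s) := by rw [hcdef, hddef]; field_simp; ring
  have hx : ∀ φ : ℝ → ℝ, ∑ v, φ (c * (S : Set V).indicator 1 v + d) =
      s * φ (1 / (2 * s)) + t * φ d := by
    intro φ
    have : ∀ v, φ (c * (S : Set V).indicator 1 v + d) =
        if v ∈ S then φ (1 / (2 * s)) else φ d := by
      intro v
      by_cases hv : v ∈ S <;> simp [hv, ← hcd]
    simp only [this, sum_ite, sum_const, nsmul_eq_mul, hc]
    simp [hs]
  have h := l1Fiedler_le_edgeVariation G (x := fun v => c * (S : Set V).indicator 1 v + d)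
    (by rw [hx fun y => y, hddef]; field_simp; ring)
    (by
      rw [hx fun y => |y|, hddef, abs_neg, abs_of_pos (by positivity), abs_of_pos (by positivity)]
      field_simp; ring)
  rw [edgeVariation_affine G _ (by positivity), hcdef, div_mul_eq_mul_div,
    le_div_iff₀ (by positivity)] at h
  exact h

theorem prod_one_sub_one_div_sq {n : ℝ} (hn : 2 ≤ n) (k : ℕ) :
    ∏ i ∈ range k, (1 - 1 / (n + (i : ℝ)) ^ 2) = (n - 1) * (n + k) / (n * (n + k - 1)) := by
  have h0 : n ≠ 0 := by positivity
  induction k with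
  | zero =>
    have h1 : n - 1 ≠ 0 := by linarith
    simp; field_simp
  | succ k ih =>
    have hk : (0 : ℝ) ≤ k := k.cast_nonneg
    have h1 : n + k - 1 ≠ 0 := by linarith
    have h2 : n + k ≠ 0 := by linarith
    have h3 : n + (k + 1) - 1 ≠ 0 := by linarith
    rw [prod_range_succ, ih]
    push_cast
    rw [show n + ((k : ℝ) + 1) - 1 = n + k by ring]
    field_simp
    ring

theorem card_mul_l1Fiedler_addPendantsSeq_le {V : Type*} [Fintype V] (G : SimpleGraph V)
    (hn : 2 ≤ Fintype.card V) {k : ℕ} (f : Fin k → V ⊕ Fin k)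
    (hf : ∀ i j, f i = Sum.inr j → (j : ℕ) < (i : ℕ)) (S : Finset V) {s t : ℕ} (hs : #S = s)
    (ht : s + t = Fintype.card V) :
    l1Fiedler (addPendantsSeq G f) * (2 * s * t) ≤
      (Fintype.card V : ℝ) * (∏ i ∈ range k, (1 - 1 / ((Fintype.card V : ℝ) + (i : ℝ)) ^ 2)) *
        edgeVariation G ((S : Set V).indicator 1) := by
  classical
  have hnR : (2 : ℝ) ≤ Fintype.card V := by exact_mod_cast hn
  have hk : (0 : ℝ) ≤ k := k.cast_nonneg
  have hE := edgeVariation_nonneg G ((S : Set V).indicator 1)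
  have hB := l1Fiedler_nonneg (addPendantsSeq G f)
  rw [prod_one_sub_one_div_sq hnR]
  have hP : 0 ≤ (Fintype.card V : ℝ) * (((Fintype.card V : ℝ) - 1) * (Fintype.card V + k) /
      (Fintype.card V * (Fintype.card V + k - 1))) := by
    have h1 : (0 : ℝ) ≤ Fintype.card V - 1 := by linarith
    have h2 : (0 : ℝ) ≤ Fintype.card V + k - 1 := by linarith
    positivity
  rcases Nat.eq_zero_or_pos s with rfl | hs0
  · simpa using mul_nonneg hP hE
  rcases Nat.eq_zero_or_pos t with rfl | ht0
  · simpa using mul_nonneg hP hE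
  obtain ⟨r, hr, hrf⟩ := exists_pendant_root f hf
  let T : Finset (V ⊕ Fin k) := univ.filter fun a => r a ∈ S
  set p := #(univ.filter fun i : Fin k => r (Sum.inr i) ∈ S) with hp
  have hpk : p ≤ k := by simpa using card_filter_le (univ : Finset (Fin k)) _
  obtain ⟨q, hq⟩ := Nat.exists_eq_add_of_le hpk
  have hT : #T = s + p := by
    simp only [T, card_filter, Fintype.sum_sum_type, hr, hp]
    simp [hs]
  have hbound := l1Fiedler_mul_card_le (addPendantsSeq G f) T (t := t + q) hT
    (by simp only [Fintype.card_sum, Fintype.card_fin]; omega) (by omega) (by omega)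
  have hind : ((T : Set (V ⊕ Fin k)).indicator 1 : V ⊕ Fin k → ℝ) =
      fun a => (S : Set V).indicator 1 (r a) := by
    funext a
    simp [Set.indicator_apply, T]
  rw [hind, edgeVariation_addPendantsSeq G f r hr hrf] at hbound
  have htR : (Fintype.card V : ℝ) = s + t := by exact_mod_cast ht.symm
  have hqR : (k : ℝ) = p + q := by exact_mod_cast hq
  have hs1 : (1 : ℝ) ≤ s := by exact_mod_cast hs0
  have ht1 : (1 : ℝ) ≤ t := by exact_mod_cast ht0
  have hp0 : (0 : ℝ) ≤ p := p.cast_nonneg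
  have hq0 : (0 : ℝ) ≤ q := q.cast_nonneg
  rw [htR, hqR]
  push_cast at hbound
  generalize edgeVariation G ((S : Set V).indicator 1) = E at *
  generalize l1Fiedler (addPendantsSeq G f) = B at *
  generalize (s : ℝ) = s at *
  generalize (t : ℝ) = t at *
  generalize (p : ℝ) = p at *
  generalize (q : ℝ) = q at *
  have hcount : s * t * (s + t + (p + q) - 1) ≤ (s + t - 1) * ((s + p) * (t + q)) := by
    nlinarith [mul_nonneg hp0 (mul_nonneg (by linarith : 0 ≤ t) (sub_nonneg.2 ht1)),
      mul_nonneg hq0 (mul_nonneg (by linarith : 0 ≤ s) (sub_nonneg.2 hs1)),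
      mul_nonneg (mul_nonneg hp0 hq0) (by linarith : 0 ≤ s + t - 1)]
  have hd : 0 < s + t + (p + q) - 1 := by linarith
  rw [show (s + t) * ((s + t - 1) * (s + t + (p + q)) / ((s + t) * (s + t + (p + q) - 1))) * E =
      (s + t - 1) * ((s + t + (p + q)) * E) / (s + t + (p + q) - 1) by
    have : s + t ≠ 0 := by linarith
    field_simp, le_div_iff₀ hd]
  calc B * (2 * s * t) * (s + t + (p + q) - 1)
      = 2 * B * (s * t * (s + t + (p + q) - 1)) := by ring
    _ ≤ 2 * B * ((s + t - 1) * ((s + p) * (t + q))) := by gcongr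
    _ = (s + t - 1) * (B * (2 * (s + p) * (t + q))) := by ring
    _ ≤ (s + t - 1) * ((s + t + (p + q)) * E) := by
      refine mul_le_mul_of_nonneg_left ?_ (by linarith)
      linarith

theorem sum_sum_abs_indicator_sub {V : Type*} [Fintype V] (S : Finset V) {s t : ℕ} (hs : #S = s)
    (ht : s + t = Fintype.card V) :
    ∑ u, ∑ v, |(S : Set V).indicator (1 : V → ℝ) u - (S : Set V).indicator 1 v| =
      2 * s * t := by
  classical
  have hc : #(univ.filter fun v => v ∉ S) = t := by
    have := card_compl S
    rw [show Sᶜ = univ.filter fun v => v ∉ S by ext; simp] at this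
    omega
  have h : ∀ u v, |(S : Set V).indicator (1 : V → ℝ) u - (S : Set V).indicator 1 v| =
      if u ∈ S then (if v ∈ S then 0 else 1) else (if v ∈ S then 1 else 0) := by
    intro u v
    by_cases hu : u ∈ S <;> by_cases hv : v ∈ S <;> simp [hu, hv]
  have h1 : ∑ v, (if v ∈ S then (0 : ℝ) else 1) = t := by
    rw [sum_ite]; simp [hc]
  have h2 : ∑ v, (if v ∈ S then (1 : ℝ) else 0) = s := by
    simp [hs]
  have h3 : ∀ u, ∑ v, (if u ∈ S then (if v ∈ S then (0 : ℝ) else 1) else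
      (if v ∈ S then 1 else 0)) = if u ∈ S then (t : ℝ) else s := by
    intro u
    split_ifs
    exacts [h1, h2]
  simp only [h, h3]
  rw [sum_ite]
  simp only [sum_const, nsmul_eq_mul, hc, filter_mem_eq_inter, univ_inter, hs]
  ring

theorem card_mul_sum_abs_le {V : Type*} [Fintype V] (x : V → ℝ) (h0 : ∑ v, x v = 0) :
    (Fintype.card V : ℝ) * ∑ u, |x u| ≤ ∑ u, ∑ v, |x u - x v| := by
  rw [mul_sum]
  refine sum_le_sum fun u _ => ?_
  have h := abs_sum_le_sum_abs (fun v => x u - x v) univ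
  simpa [sum_sub_distrib, h0, abs_mul] using h

theorem exists_sum_eq_zero_sum_abs_eq_one {V : Type*} [Fintype V] (hn : 2 ≤ Fintype.card V) :
    ∃ x : V → ℝ, ∑ v, x v = 0 ∧ ∑ v, |x v| = 1 := by
  classical
  obtain ⟨a, b, hab⟩ := Fintype.one_lt_card_iff.1 hn
  have h : ∀ v, |(Pi.single a (1 / 2) - Pi.single b (1 / 2) : V → ℝ) v| =
      (Pi.single a (1 / 2) + Pi.single b (1 / 2) : V → ℝ) v := by
    intro v
    rcases eq_or_ne v a with rfl | hva
    · simp [hab]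
    · rcases eq_or_ne v b with rfl | hvb
      · simp [hab.symm]
      · simp [hva, hvb]
  refine ⟨Pi.single a (1 / 2) - Pi.single b (1 / 2), by simp, ?_⟩
  simp only [h]
  simp only [Pi.add_apply, sum_add_distrib, sum_pi_single', mem_univ, if_true]
  norm_num

/-- Let `G` be a connected graph on `n ≥ 2` vertices and let `G^k` be
obtained from `G` by successively adding `k` pendant vertices (vertex `i` is attached to
`f i`, a vertex of the graph built so far).  Then
`b(G^k) ≤ b(G) ∏_{i=0}^{k-1} (1 - 1/(n+i)²)`. -/
theorem stmt16 {V : Type*} [Fintype V] (G : SimpleGraph V) (hG : G.Connected)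
    (hn : 2 ≤ Fintype.card V) {k : ℕ} (f : Fin k → V ⊕ Fin k)
    (hf : ∀ i j, f i = Sum.inr j → (j : ℕ) < (i : ℕ)) :
    l1Fiedler (addPendantsSeq G f) ≤
      l1Fiedler G * ∏ i ∈ Finset.range k, (1 - 1 / ((Fintype.card V : ℝ) + (i : ℝ)) ^ 2) := by
  classical
  have hnR : (2 : ℝ) ≤ Fintype.card V := by exact_mod_cast hn
  have hn0 : (0 : ℝ) < Fintype.card V := by linarith
  have hB := l1Fiedler_nonneg (addPendantsSeq G f)
  have hcut := card_mul_l1Fiedler_addPendantsSeq_le G hn f hf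
  have hP : 0 < ∏ i ∈ Finset.range k, (1 - 1 / ((Fintype.card V : ℝ) + (i : ℝ)) ^ 2) := by
    have hk : (0 : ℝ) ≤ k := k.cast_nonneg
    rw [prod_one_sub_one_div_sq hnR]
    exact div_pos (mul_pos (by linarith) (by linarith)) (mul_pos hn0 (by linarith))
  generalize (∏ i ∈ Finset.range k, (1 - 1 / ((Fintype.card V : ℝ) + (i : ℝ)) ^ 2)) = P at *
  generalize l1Fiedler (addPendantsSeq G f) = B at *
  rw [← div_le_iff₀ hP]
  obtain ⟨x₀, hx₀⟩ := exists_sum_eq_zero_sum_abs_eq_one hn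
  refine le_csInf ⟨_, x₀, hx₀.1, hx₀.2, rfl⟩ ?_
  rintro _ ⟨x, h0, h1, rfl⟩
  change B / P ≤ edgeVariation G x
  rw [div_le_iff₀ hP]
  have hsplit : ∀ y : V → ℝ,
      ∑ u, ∑ v, (Fintype.card V * P * (1 / 2) * (if G.Adj u v then 1 else 0) - B) * |y u - y v| =
        Fintype.card V * P * edgeVariation G y - B * ∑ u, ∑ v, |y u - y v| := by
    intro y
    unfold edgeVariation
    simp only [sub_mul, sum_sub_distrib, mul_assoc, ← mul_sum, ite_mul, one_mul, zero_mul]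
  have hmain := sum_mul_abs_sub_nonneg_of_indicator
    (fun u v => Fintype.card V * P * (1 / 2) * (if G.Adj u v then 1 else 0) - B) (fun S => by
      obtain ⟨S, rfl⟩ := S.toFinite.exists_finset_coe
      obtain ⟨t, ht⟩ := Nat.exists_eq_add_of_le (card_le_univ S)
      rw [hsplit, sum_sum_abs_indicator_sub S rfl ht.symm]
      exact sub_nonneg.2 (hcut S rfl ht.symm)) x
  rw [hsplit] at hmain
  have hsum := mul_le_mul_of_nonneg_left (card_mul_sum_abs_le x h0) hB
  rw [h1] at hsum
  refine le_of_mul_le_mul_left ?_ hn0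
  linarith
end
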